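/- For a two-dimensional complex Finsler metric on D, the hh̄-Riemann type tensor satisfies R_{r̄jh̄k}·l̄^r·l^j·l̄^h·l^k = K and R_{r̄jh̄k}·m̄^r·m^j·m̄^h·m^k = W at every point of D; in particular the horizontal holomorphic sectional curvatures in directions λ and μ equal 2K and 2W respectively. -/

import Mathlib

open Complex

noncomputable section

namespace CFinsler

/-- A point of `T'M` in local coordinates: `(z, η) ∈ ℂⁿ × ℂⁿ`. -/
abbrev Pt (n : ℕ) := (Fin n → ℂ) × (Fin n → ℂ)

variable {n : ℕ}

/-- Wirtinger derivative `∂f/∂z^k`. -/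
def dz (f : Pt n → ℂ) (k : Fin n) (p : Pt n) : ℂ :=
  (1 / 2) * (fderiv ℝ f p ((Pi.single k 1 : Fin n → ℂ), 0) -
    Complex.I * fderiv ℝ f p ((Pi.single k Complex.I : Fin n → ℂ), 0))

/-- Wirtinger derivative `∂f/∂z̄^k`. -/
def dzbar (f : Pt n → ℂ) (k : Fin n) (p : Pt n) : ℂ :=
  (1 / 2) * (fderiv ℝ f p ((Pi.single k 1 : Fin n → ℂ), 0) +
    Complex.I * fderiv ℝ f p ((Pi.single k Complex.I : Fin n → ℂ), 0))

/-- Wirtinger derivative `∂f/∂η^k`. -/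
def de (f : Pt n → ℂ) (k : Fin n) (p : Pt n) : ℂ :=
  (1 / 2) * (fderiv ℝ f p (0, (Pi.single k 1 : Fin n → ℂ)) -
    Complex.I * fderiv ℝ f p (0, (Pi.single k Complex.I : Fin n → ℂ)))

/-- Wirtinger derivative `∂f/∂η̄^k`. -/
def debar (f : Pt n → ℂ) (k : Fin n) (p : Pt n) : ℂ :=
  (1 / 2) * (fderiv ℝ f p (0, (Pi.single k 1 : Fin n → ℂ)) +
    Complex.I * fderiv ℝ f p (0, (Pi.single k Complex.I : Fin n → ℂ)))

/-- The fundamental metric tensor `g_{i j̄} := ∂²L/∂η^i ∂η̄^j`. -/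
def gm (L : Pt n → ℂ) (i j : Fin n) : Pt n → ℂ := de (debar L j) i

/-- `L` is an `n`-dimensional complex Finsler metric on `D`. -/
structure IsCFM (n : ℕ) (D : Set (Pt n)) (L : Pt n → ℂ) : Prop where
  openD : IsOpen D
  fiber_ne : ∀ p ∈ D, p.2 ≠ 0
  conic : ∀ p ∈ D, ∀ lam : ℂ, lam ≠ 0 → (p.1, lam • p.2) ∈ D
  smooth : ContDiffOn ℝ (⊤ : ℕ∞) L D
  real_im : ∀ p ∈ D, (L p).im = 0
  pos : ∀ p ∈ D, 0 < (L p).re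
  homog : ∀ p ∈ D, ∀ lam : ℂ, lam ≠ 0 →
    L (p.1, lam • p.2) = ((Complex.normSq lam : ℝ) : ℂ) * L p
  hermitian : ∀ p ∈ D, ∀ i j, (starRingEnd ℂ) (gm L i j p) = gm L j i p
  posdef : ∀ p ∈ D, ∀ v : Fin n → ℂ, v ≠ 0 →
    0 < (∑ i, ∑ j, gm L i j p * v i * (starRingEnd ℂ) (v j)).re

variable (L : Pt n → ℂ)

/-- The metric tensor as a matrix at a point. -/
def gmat (p : Pt n) : Matrix (Fin n) (Fin n) ℂ := fun i j => gm L i j p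

/-- The inverse metric tensor `g^{l̄ i}`. -/
def gi (l i : Fin n) (p : Pt n) : ℂ := (gmat L p)⁻¹ l i

/-- The Chern–Finsler nonlinear connection coefficients
`N^i_k := g^{m̄ i} (∂g_{l m̄}/∂z^k) η^l`. -/
def Nc (i k : Fin n) (p : Pt n) : ℂ :=
  ∑ m, ∑ l, gi L m i p * dz (gm L l m) k p * p.2 l

/-- The horizontal derivation `δ_k := ∂/∂z^k − N^j_k ∂/∂η^j`. -/
def del (f : Pt n → ℂ) (k : Fin n) (p : Pt n) : ℂ :=
  dz f k p - ∑ j, Nc L j k p * de f j p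

/-- The conjugate horizontal derivation `δ_k̄ := ∂/∂z̄^k − N̄^j_k ∂/∂η̄^j`. -/
def delbar (f : Pt n → ℂ) (k : Fin n) (p : Pt n) : ℂ :=
  dzbar f k p - ∑ j, (starRingEnd ℂ) (Nc L j k p) * debar f j p

/-- The horizontal Chern–Finsler connection coefficients `L^i_{jk} := g^{l̄ i} δ_k(g_{j l̄})`. -/
def Lc (i j k : Fin n) (p : Pt n) : ℂ := ∑ l, gi L l i p * del L (gm L j l) k p

/-- The vertical Chern–Finsler connection coefficients `C^i_{jk} := g^{l̄ i} ∂g_{j l̄}/∂η^k`. -/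
def Cc (i j k : Fin n) (p : Pt n) : ℂ := ∑ l, gi L l i p * de (gm L j l) k p

/-- The spray coefficients `G^i := ½ N^i_j η^j`. -/
def Gs (i : Fin n) (p : Pt n) : ℂ := (1 / 2) * ∑ j, Nc L i j p * p.2 j

/-- The canonical horizontal derivation `δ̊_k := ∂/∂z^k − (∂G^j/∂η^k) ∂/∂η^j`. -/
def delc (f : Pt n → ℂ) (k : Fin n) (p : Pt n) : ℂ :=
  dz f k p - ∑ j, de (Gs L j) k p * de f j p

/-- `F := √L`. -/
def Fh (p : Pt n) : ℂ := (Real.sqrt ((L p).re) : ℂ)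

/-- `l^i := η^i / F`. -/
def lup (i : Fin n) (p : Pt n) : ℂ := p.2 i / Fh L p

/-- `l_i := g_{i j̄} η̄^j / F`. -/
def llow (i : Fin n) (p : Pt n) : ℂ :=
  (∑ j, gm L i j p * (starRingEnd ℂ) (p.2 j)) / Fh L p

/-- `√g` where `g := det(g_{i j̄})`. -/
def sg (p : Pt n) : ℂ := (Real.sqrt ((gmat L p).det.re) : ℂ)

/-- The metric is Kähler. -/
def IsKahler (D : Set (Pt n)) : Prop := ∀ p ∈ D, ∀ i j k, Lc L i j k p = Lc L i k j p

/-- The metric is weakly Kähler. -/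
def IsWeaklyKahler (D : Set (Pt n)) : Prop :=
  ∀ p ∈ D, ∀ k, (∑ i, ∑ j, ∑ l, gm L i l p * (Lc L i j k p - Lc L i k j p) *
    p.2 j * (starRingEnd ℂ) (p.2 l)) = 0

/-- The metric is purely Hermitian: `g_{i j̄}` does not depend on the fibre variable. -/
def IsPurelyHermitian (D : Set (Pt n)) : Prop :=
  ∀ p ∈ D, ∀ i j k, de (gm L i j) k p = 0 ∧ debar (gm L i j) k p = 0

/-- The metric is a complex Berwald metric: Kähler with `L^i_{jk}` independent of the
fibre variable. -/
def IsBerwald (D : Set (Pt n)) : Prop :=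
  IsKahler L D ∧ ∀ p ∈ D, ∀ i j k l, de (Lc L i j k) l p = 0 ∧ debar (Lc L i j k) l p = 0

/-- The metric is a complex Landsberg metric: the Berwald and Rund connections coincide. -/
def IsLandsberg (D : Set (Pt n)) : Prop :=
  ∀ p ∈ D, ∀ i j k, de (de (Gs L i) k) j p =
    (1 / 2) * ∑ l, gi L l i p * (delc L (gm L j l) k p + delc L (gm L k l) j p)

/-- `m^i` of the local complex Berwald frame: `m¹ = −l₂/√g`, `m² = l₁/√g`. -/
def mup (L : Pt 2 → ℂ) (i : Fin 2) (p : Pt 2) : ℂ :=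
  if i = 0 then -(llow L 1 p) / sg L p else llow L 0 p / sg L p

/-- `m_i := g_{i j̄} m̄^j`. -/
def mlow (L : Pt 2 → ℂ) (i : Fin 2) (p : Pt 2) : ℂ :=
  ∑ j, gm L i j p * (starRingEnd ℂ) (mup L j p)

/-- `A := m^j m^k l_h C^h_{kj}`. -/
def sA (L : Pt 2 → ℂ) (p : Pt 2) : ℂ :=
  ∑ j, ∑ k, ∑ h, mup L j p * mup L k p * llow L h p * Cc L h k j p

/-- `B := m_h m^k m^j C^h_{jk}`. -/
def sB (L : Pt 2 → ℂ) (p : Pt 2) : ℂ :=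
  ∑ j, ∑ k, ∑ h, mlow L h p * mup L k p * mup L j p * Cc L h j k p

/-- `J := l^j l^k l_i L^i_{jk}`. -/
def sJ (L : Pt 2 → ℂ) (p : Pt 2) : ℂ :=
  ∑ j, ∑ k, ∑ i, lup L j p * lup L k p * llow L i p * Lc L i j k p

/-- `U := m^j l^k l_i L^i_{jk}`. -/
def sU (L : Pt 2 → ℂ) (p : Pt 2) : ℂ :=
  ∑ j, ∑ k, ∑ i, mup L j p * lup L k p * llow L i p * Lc L i j k p

/-- `V := l^j m^k l_i L^i_{jk}`. -/
def sV (L : Pt 2 → ℂ) (p : Pt 2) : ℂ :=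
  ∑ j, ∑ k, ∑ i, lup L j p * mup L k p * llow L i p * Lc L i j k p

/-- `X := m^j m^k l_i L^i_{jk}`. -/
def sX (L : Pt 2 → ℂ) (p : Pt 2) : ℂ :=
  ∑ j, ∑ k, ∑ i, mup L j p * mup L k p * llow L i p * Lc L i j k p

/-- `O := l^j l^k m_i L^i_{jk}`. -/
def sO (L : Pt 2 → ℂ) (p : Pt 2) : ℂ :=
  ∑ j, ∑ k, ∑ i, lup L j p * lup L k p * mlow L i p * Lc L i j k p

/-- `Y := m^j l^k m_i L^i_{jk}`. -/
def sY (L : Pt 2 → ℂ) (p : Pt 2) : ℂ :=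
  ∑ j, ∑ k, ∑ i, mup L j p * lup L k p * mlow L i p * Lc L i j k p

/-- `E := l^j m^k m_i L^i_{jk}`. -/
def sE (L : Pt 2 → ℂ) (p : Pt 2) : ℂ :=
  ∑ j, ∑ k, ∑ i, lup L j p * mup L k p * mlow L i p * Lc L i j k p

/-- `H := m^j m^k m_i L^i_{jk}`. -/
def sH (L : Pt 2 → ℂ) (p : Pt 2) : ℂ :=
  ∑ j, ∑ k, ∑ i, mup L j p * mup L k p * mlow L i p * Lc L i j k p

/-- The vertical curvature invariant `I := −(∂B/∂η̄^s) m̄^s − B B̄/2`. -/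
def vI (L : Pt 2 → ℂ) (p : Pt 2) : ℂ :=
  -(∑ s, debar (sB L) s p * (starRingEnd ℂ) (mup L s p)) -
    sB L p * (starRingEnd ℂ) (sB L p) / 2

/-- The `v v̄`-Riemann type tensor `S_{r̄ j h̄ k} := −g_{i r̄} ∂C^i_{jk}/∂η̄^h`. -/
def Sv (L : Pt 2 → ℂ) (r j h k : Fin 2) (p : Pt 2) : ℂ :=
  -∑ i, gm L i r p * debar (Cc L i j k) h p

/-- The `h h̄`-Riemann type tensor
`R_{r̄ j h̄ k} := g_{i r̄} (−δ_h̄(L^i_{jk}) − δ_h̄(N^l_k) C^i_{jl})`. -/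
def Rh (L : Pt 2 → ℂ) (r j h k : Fin 2) (p : Pt 2) : ℂ :=
  ∑ i, gm L i r p *
    (-(delbar L (Lc L i j k) h p) - ∑ l, delbar L (Nc L l k) h p * Cc L i j l p)

/-- The horizontal curvature invariant `K := −(1/F) δ_k̄(J) η̄^k`. -/
def hK (L : Pt 2 → ℂ) (p : Pt 2) : ℂ :=
  -(1 / Fh L p) * ∑ k, delbar L (sJ L) k p * (starRingEnd ℂ) (p.2 k)

/-- The horizontal curvature invariant
`W := −δ_s̄(H) m̄^s − ½ H (V̄+H̄) − B F δ_s̄(E) m̄^s`. -/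
def hW (L : Pt 2 → ℂ) (p : Pt 2) : ℂ :=
  -(∑ s, delbar L (sH L) s p * (starRingEnd ℂ) (mup L s p)) -
    (1 / 2) * sH L p * ((starRingEnd ℂ) (sV L p) + (starRingEnd ℂ) (sH L p)) -
    sB L p * Fh L p * ∑ s, delbar L (sE L) s p * (starRingEnd ℂ) (mup L s p)

/-- The weak symmetry condition `R_{0̄ k 0̄ 0} = R_{0̄ 0 0̄ k}`, i.e.
`R_{r̄ k h̄ s} η̄^r η̄^h η^s = R_{r̄ s h̄ k} η̄^r η^s η̄^h`. -/
def WeakSym (L : Pt 2 → ℂ) (D : Set (Pt 2)) : Prop :=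
  ∀ p ∈ D, ∀ k,
    (∑ r, ∑ h, ∑ s, Rh L r k h s p * (starRingEnd ℂ) (p.2 r) *
      (starRingEnd ℂ) (p.2 h) * p.2 s) =
    ∑ r, ∑ s, ∑ h, Rh L r s h k p * (starRingEnd ℂ) (p.2 r) * p.2 s *
      (starRingEnd ℂ) (p.2 h)


open scoped Topology ContDiff

/-- `X` is a complex tangent vector at `p`, acting on functions through their differential. -/
def IsTangent (X : (Pt n → ℂ) → ℂ) (p : Pt n) : Prop :=
  ∃ φ : (Pt n →L[ℝ] ℂ) →ₗ[ℂ] ℂ, ∀ f, X f = φ (fderiv ℝ f p)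

namespace IsTangent

variable {X Y : (Pt n → ℂ) → ℂ} {p : Pt n} {f g : Pt n → ℂ}

theorem of_fderiv_apply (v : Pt n) : IsTangent (fun f => fderiv ℝ f p v) p :=
  ⟨{ toFun := fun T => T v, map_add' := fun _ _ => rfl, map_smul' := fun _ _ => rfl },
    fun _ => rfl⟩

theorem add (hX : IsTangent X p) (hY : IsTangent Y p) : IsTangent (fun f => X f + Y f) p := by
  obtain ⟨φ, hφ⟩ := hX
  obtain ⟨ψ, hψ⟩ := hY
  exact ⟨φ + ψ, fun f => by simp [hφ, hψ]⟩

theorem const_mul (c : ℂ) (hX : IsTangent X p) : IsTangent (fun f => c * X f) p := by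
  obtain ⟨φ, hφ⟩ := hX
  exact ⟨c • φ, fun f => by simp [hφ]⟩

theorem sub (hX : IsTangent X p) (hY : IsTangent Y p) : IsTangent (fun f => X f - Y f) p := by
  simpa [sub_eq_add_neg] using hX.add (hY.const_mul (-1))

theorem sum {ι : Type*} (s : Finset ι) {Z : ι → (Pt n → ℂ) → ℂ}
    (h : ∀ i ∈ s, IsTangent (Z i) p) : IsTangent (fun f => ∑ i ∈ s, Z i f) p := by
  choose! φ hφ using h
  exact ⟨∑ i ∈ s, φ i, fun f => by
    rw [LinearMap.sum_apply]; exact Finset.sum_congr rfl fun i hi => hφ i hi f⟩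

theorem map_congr (hX : IsTangent X p) (h : f =ᶠ[𝓝 p] g) : X f = X g := by
  obtain ⟨φ, hφ⟩ := hX
  rw [hφ, hφ, h.fderiv_eq]

theorem map_const (hX : IsTangent X p) (c : ℂ) : X (fun _ => c) = 0 := by
  obtain ⟨φ, hφ⟩ := hX
  simp [hφ]

theorem map_mul (hX : IsTangent X p) (hf : DifferentiableAt ℝ f p) (hg : DifferentiableAt ℝ g p) :
    X (fun q => f q * g q) = X f * g p + f p * X g := by
  obtain ⟨φ, hφ⟩ := hX
  rw [hφ, hφ, hφ, fderiv_fun_mul hf hg, map_add, map_smul, map_smul]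
  simp only [smul_eq_mul]
  ring

theorem map_sub (hX : IsTangent X p) (hf : DifferentiableAt ℝ f p) (hg : DifferentiableAt ℝ g p) :
    X (fun q => f q - g q) = X f - X g := by
  obtain ⟨φ, hφ⟩ := hX
  rw [hφ, hφ, hφ, fderiv_fun_sub hf hg, _root_.map_sub]

theorem map_sum (hX : IsTangent X p) {ι : Type*} (s : Finset ι) {u : ι → Pt n → ℂ}
    (h : ∀ i ∈ s, DifferentiableAt ℝ (u i) p) :
    X (fun q => ∑ i ∈ s, u i q) = ∑ i ∈ s, X (u i) := by
  obtain ⟨φ, hφ⟩ := hX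
  simp only [hφ]
  rw [fderiv_fun_sum h, _root_.map_sum]

theorem map_sum_mul (hX : IsTangent X p) {ι : Type*} (s : Finset ι) {u w : ι → Pt n → ℂ}
    (hu : ∀ i ∈ s, DifferentiableAt ℝ (u i) p) (hw : ∀ i ∈ s, DifferentiableAt ℝ (w i) p) :
    X (fun q => ∑ i ∈ s, u i q * w i q) = ∑ i ∈ s, (X (u i) * w i p + u i p * X (w i)) := by
  rw [hX.map_sum s fun i hi => (hu i hi).fun_mul (hw i hi)]
  exact Finset.sum_congr rfl fun i hi => hX.map_mul (hu i hi) (hw i hi)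

/-- Derivative of a contraction with eigenvectors of the derivation. -/
theorem map_contraction (hX : IsTangent X p) {u v w : Fin n → Pt n → ℂ}
    {M : Fin n → Fin n → Fin n → Pt n → ℂ} {a b c : ℂ}
    (hu : ∀ i, DifferentiableAt ℝ (u i) p) (hv : ∀ i, DifferentiableAt ℝ (v i) p)
    (hw : ∀ i, DifferentiableAt ℝ (w i) p) (hM : ∀ i j k, DifferentiableAt ℝ (M i j k) p)
    (ha : ∀ i, X (u i) = a * u i p) (hb : ∀ i, X (v i) = b * v i p)
    (hc : ∀ i, X (w i) = c * w i p) :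
    X (fun q => ∑ j, ∑ k, ∑ i, u j q * v k q * w i q * M i j k q) =
      (∑ j, ∑ k, ∑ i, u j p * v k p * w i p * X (M i j k)) +
        (a + b + c) * ∑ j, ∑ k, ∑ i, u j p * v k p * w i p * M i j k p := by
  have huv (j k) := (hu j).fun_mul (hv k)
  have huvw (j k i) := (huv j k).fun_mul (hw i)
  have hd (j k i) := (huvw j k i).fun_mul (hM i j k)
  have hd₁ (j k) := DifferentiableAt.fun_sum (u := Finset.univ) fun i _ => hd j k i
  rw [hX.map_sum _ fun j _ => DifferentiableAt.fun_sum fun k _ => hd₁ j k, Finset.mul_sum,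
    ← Finset.sum_add_distrib]
  refine Finset.sum_congr rfl fun j _ => ?_
  rw [hX.map_sum _ fun k _ => hd₁ j k, Finset.mul_sum, ← Finset.sum_add_distrib]
  refine Finset.sum_congr rfl fun k _ => ?_
  rw [hX.map_sum _ fun i _ => hd j k i, Finset.mul_sum, ← Finset.sum_add_distrib]
  refine Finset.sum_congr rfl fun i _ => ?_
  rw [hX.map_mul (huvw j k i) (hM i j k), hX.map_mul (huv j k) (hw i), hX.map_mul (hu j) (hv k),
    ha, hb, hc]
  ring

end IsTangent

section Wirtinger

variable (k : Fin n) (p : Pt n)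

theorem isTangent_dz : IsTangent (fun f => dz f k p) p :=
  ((IsTangent.of_fderiv_apply _).sub ((IsTangent.of_fderiv_apply _).const_mul _)).const_mul _

theorem isTangent_dzbar : IsTangent (fun f => dzbar f k p) p :=
  ((IsTangent.of_fderiv_apply _).add ((IsTangent.of_fderiv_apply _).const_mul _)).const_mul _

theorem isTangent_de : IsTangent (fun f => de f k p) p :=
  ((IsTangent.of_fderiv_apply _).sub ((IsTangent.of_fderiv_apply _).const_mul _)).const_mul _

theorem isTangent_debar : IsTangent (fun f => debar f k p) p :=
  ((IsTangent.of_fderiv_apply _).add ((IsTangent.of_fderiv_apply _).const_mul _)).const_mul _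

theorem isTangent_del (L : Pt n → ℂ) : IsTangent (fun f => del L f k p) p :=
  (isTangent_dz k p).sub (IsTangent.sum _ fun j _ => (isTangent_de j p).const_mul _)

theorem isTangent_delbar (L : Pt n → ℂ) : IsTangent (fun f => delbar L f k p) p :=
  (isTangent_dzbar k p).sub (IsTangent.sum _ fun j _ => (isTangent_debar j p).const_mul _)

theorem fderiv_conj (f : Pt n → ℂ) (v : Pt n) :
    fderiv ℝ (fun q => (starRingEnd ℂ) (f q)) p v = (starRingEnd ℂ) (fderiv ℝ f p v) := by
  have := conjCLE.comp_fderiv (f := f) (x := p)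
  exact congrArg (fun T : Pt n →L[ℝ] ℂ => T v) this

theorem dzbar_conj (f : Pt n → ℂ) :
    dzbar (fun q => (starRingEnd ℂ) (f q)) k p = (starRingEnd ℂ) (dz f k p) := by
  simp [dz, dzbar, fderiv_conj, sub_eq_add_neg, conj_ofNat]

theorem de_conj (f : Pt n → ℂ) :
    de (fun q => (starRingEnd ℂ) (f q)) k p = (starRingEnd ℂ) (debar f k p) := by
  simp [de, debar, fderiv_conj, sub_eq_add_neg, conj_ofNat]

theorem debar_conj (f : Pt n → ℂ) :
    debar (fun q => (starRingEnd ℂ) (f q)) k p = (starRingEnd ℂ) (de f k p) := by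
  simp [de, debar, fderiv_conj, sub_eq_add_neg, conj_ofNat]

theorem delbar_conj (L f : Pt n → ℂ) :
    delbar L (fun q => (starRingEnd ℂ) (f q)) k p = (starRingEnd ℂ) (del L f k p) := by
  simp [del, delbar, dzbar_conj, debar_conj]

theorem fderiv_fibre (i : Fin n) (v : Pt n) : fderiv ℝ (fun q : Pt n => q.2 i) p v = v.2 i :=
  congrArg (fun T : Pt n →L[ℝ] ℂ => T v)
    ((ContinuousLinearMap.proj (R := ℝ) (φ := fun _ : Fin n => ℂ) i).comp
      (ContinuousLinearMap.snd ℝ (Fin n → ℂ) (Fin n → ℂ))).fderiv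

theorem dz_fibre (i : Fin n) : dz (fun q => q.2 i) k p = 0 := by
  simp [dz, fderiv_fibre]

theorem dzbar_fibre (i : Fin n) : dzbar (fun q => q.2 i) k p = 0 := by
  simp [dzbar, fderiv_fibre]

theorem de_fibre (i : Fin n) : de (fun q => q.2 i) k p = if i = k then 1 else 0 := by
  rcases eq_or_ne i k with rfl | h
  · simp [de, fderiv_fibre]; norm_num
  · simp [de, fderiv_fibre, h]

theorem debar_fibre (i : Fin n) : debar (fun q => q.2 i) k p = 0 := by
  rcases eq_or_ne i k with rfl | h
  · simp [debar, fderiv_fibre]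
  · simp [debar, fderiv_fibre, h]

theorem de_conj_fibre (i : Fin n) : de (fun q => (starRingEnd ℂ) (q.2 i)) k p = 0 := by
  rw [de_conj k p (fun q => q.2 i), debar_fibre, map_zero]

theorem delbar_fibre (L : Pt n → ℂ) (i : Fin n) : delbar L (fun q => q.2 i) k p = 0 := by
  simp [delbar, dzbar_fibre, debar_fibre]

end Wirtinger

theorem contDiff_fibre (i : Fin n) : ContDiff ℝ ∞ (fun q : Pt n => q.2 i) :=
  ((ContinuousLinearMap.proj (R := ℝ) (φ := fun _ : Fin n => ℂ) i).comp
      (ContinuousLinearMap.snd ℝ (Fin n → ℂ) (Fin n → ℂ))).contDiff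

theorem differentiableAt_fibre (i : Fin n) (p : Pt n) :
    DifferentiableAt ℝ (fun q : Pt n => q.2 i) p :=
  (contDiff_fibre i).differentiable (by simp) p

theorem _root_.DifferentiableAt.starRingEnd {E : Type*} [NormedAddCommGroup E] [NormedSpace ℝ E]
    {p : E} {f : E → ℂ} (hf : DifferentiableAt ℝ f p) :
    DifferentiableAt ℝ (fun q => (starRingEnd ℂ) (f q)) p :=
  conjCLE.differentiableAt.comp p hf

theorem _root_.DifferentiableAt.div_complex {E : Type*} [NormedAddCommGroup E] [NormedSpace ℝ E]
    {p : E} {f g : E → ℂ} (hf : DifferentiableAt ℝ f p) (hg : DifferentiableAt ℝ g p)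
    (h0 : g p ≠ 0) : DifferentiableAt ℝ (fun q => f q / g q) p := by
  simpa only [div_eq_mul_inv] using hf.fun_mul (hg.fun_inv h0)

section Smooth

variable {D : Set (Pt n)} {f : Pt n → ℂ}

theorem _root_.ContDiffOn.fderiv_apply_const (hf : ContDiffOn ℝ ∞ f D) (hD : IsOpen D) (v : Pt n) :
    ContDiffOn ℝ ∞ (fun q => fderiv ℝ f q v) D :=
  (hf.fderiv_of_isOpen hD (by simp)).clm_apply contDiffOn_const

theorem _root_.ContDiffOn.dz (hf : ContDiffOn ℝ ∞ f D) (hD : IsOpen D) (k : Fin n) :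
    ContDiffOn ℝ ∞ (dz f k) D :=
  contDiffOn_const.mul ((hf.fderiv_apply_const hD _).sub
    (contDiffOn_const.mul (hf.fderiv_apply_const hD _)))

theorem _root_.ContDiffOn.de (hf : ContDiffOn ℝ ∞ f D) (hD : IsOpen D) (k : Fin n) :
    ContDiffOn ℝ ∞ (de f k) D :=
  contDiffOn_const.mul ((hf.fderiv_apply_const hD _).sub
    (contDiffOn_const.mul (hf.fderiv_apply_const hD _)))

theorem _root_.ContDiffOn.debar (hf : ContDiffOn ℝ ∞ f D) (hD : IsOpen D) (k : Fin n) :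
    ContDiffOn ℝ ∞ (debar f k) D :=
  contDiffOn_const.mul ((hf.fderiv_apply_const hD _).add
    (contDiffOn_const.mul (hf.fderiv_apply_const hD _)))

theorem _root_.ContDiffOn.differentiableAt_of_isOpen (hf : ContDiffOn ℝ ∞ f D) (hD : IsOpen D)
    {p : Pt n} (hp : p ∈ D) : DifferentiableAt ℝ f p :=
  (hf.contDiffAt (hD.mem_nhds hp)).differentiableAt (by simp)

/-- Wirtinger derivatives in the fibre directions commute. -/
theorem de_comm (hf : ContDiffOn ℝ ∞ f D) (hD : IsOpen D) {p : Pt n} (hp : p ∈ D)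
    (i j : Fin n) : de (de f i) j p = de (de f j) i p := by
  have hs : IsSymmSndFDerivAt ℝ f p :=
    (hf.contDiffAt (hD.mem_nhds hp)).isSymmSndFDerivAt
      (by simpa using ENat.LEInfty.out)
  have hd : DifferentiableAt ℝ (fderiv ℝ f) p :=
    ((hf.fderiv_of_isOpen (m := ∞) hD (by simp)).contDiffAt (hD.mem_nhds hp)).differentiableAt
      (by simp)
  have hv (v w : Pt n) :
      fderiv ℝ (fun q => fderiv ℝ f q v) p w = fderiv ℝ (fderiv ℝ f) p w v := by
    rw [fderiv_clm_apply hd (differentiableAt_const v)]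
    simp
  have hda (v : Pt n) : DifferentiableAt ℝ (fun q => fderiv ℝ f q v) p :=
    hd.clm_apply (differentiableAt_const v)
  have key (i : Fin n) (w : Pt n) : fderiv ℝ (de f i) p w =
      1 / 2 * (fderiv ℝ (fderiv ℝ f) p w (0, Pi.single i 1) -
        I * fderiv ℝ (fderiv ℝ f) p w (0, Pi.single i I)) := by
    have h := (((hda (0, Pi.single i 1)).hasFDerivAt.sub
      ((hda (0, Pi.single i I)).hasFDerivAt.const_mul I)).const_mul (1 / 2)).fderiv
    refine (congrArg (fun T : Pt n →L[ℝ] ℂ => T w) h).trans ?_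
    simp [hv]
  simp only [de.eq_def (de f i), de.eq_def (de f j), key]
  rw [hs (0, Pi.single j 1) (0, Pi.single i 1), hs (0, Pi.single j 1) (0, Pi.single i I),
    hs (0, Pi.single j I) (0, Pi.single i 1), hs (0, Pi.single j I) (0, Pi.single i I)]
  ring

end Smooth

theorem sum_conj_mul_apply (T : Pt n →L[ℝ] ℂ) (v : Fin n → ℂ) :
    ∑ k, (starRingEnd ℂ) (v k) * (T (0, Pi.single k 1) + I * T (0, Pi.single k I)) =
      T (0, v) + I * T (0, I • v) := by
  have hv (w : Fin n → ℂ) : T (0, w) =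
      ∑ k, ((w k).re * T (0, Pi.single k 1) + (w k).im * T (0, Pi.single k I)) := by
    have hw : ((0, w) : Pt n) = ∑ k, ((w k).re • ((0, Pi.single k 1) : Pt n) +
        (w k).im • ((0, Pi.single k I) : Pt n)) := by
      refine Prod.ext ?_ ?_
      · simp [Prod.fst_sum]
      · ext j
        simp [Prod.snd_sum, Finset.sum_apply, Pi.single_apply, Finset.sum_add_distrib]
    rw [hw, map_sum]
    refine Finset.sum_congr rfl fun k _ => ?_
    rw [map_add, map_smul, map_smul, real_smul, real_smul]
  rw [hv v, hv (I • v), Finset.mul_sum, ← Finset.sum_add_distrib]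
  refine Finset.sum_congr rfl fun k _ => ?_
  have hc : (starRingEnd ℂ) (v k) = (v k).re - (v k).im * I :=
    Complex.ext (by simp) (by simp)
  rw [hc]
  simp only [Pi.smul_apply, smul_eq_mul, mul_re, mul_im, I_re, I_im, zero_mul, one_mul, zero_sub,
    zero_add, ofReal_neg]
  linear_combination (-(v k).im * T (0, Pi.single k I) : ℂ) * I_mul_I

theorem _root_.ContDiffOn.matrix_det {m : Type*} [Fintype m] [DecidableEq m] {D : Set (Pt n)}
    {M : Pt n → Matrix m m ℂ} (hM : ∀ i j, ContDiffOn ℝ ∞ (fun q => M q i j) D) :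
    ContDiffOn ℝ ∞ (fun q => (M q).det) D := by
  simp only [Matrix.det_apply]
  exact ContDiffOn.sum fun σ _ => (contDiffOn_prod fun i _ => hM _ _).const_smul _

section Frame

variable {L : Pt n → ℂ} {p : Pt n}

theorem conj_lup (i : Fin n) :
    (starRingEnd ℂ) (lup L i p) = (starRingEnd ℂ) (p.2 i) / Fh L p := by
  simp [lup, Fh]

theorem sum_gm_mul_conj_lup (i : Fin n) :
    ∑ j, gm L i j p * (starRingEnd ℂ) (lup L j p) = llow L i p := by
  simp only [conj_lup, llow, Finset.sum_div, mul_div_assoc]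

/-- Contraction of the horizontal curvature tensor with a single vector. -/
theorem sum_Rh (v : Fin n → ℂ) (w : Fin n → ℂ)
    (hw : ∀ i, ∑ r, gm L i r p * (starRingEnd ℂ) (v r) = w i) :
    (∑ r, ∑ j, ∑ h, ∑ k, (∑ i, gm L i r p *
        (-(delbar L (Lc L i j k) h p) - ∑ l, delbar L (Nc L l k) h p * Cc L i j l p)) *
        (starRingEnd ℂ) (v r) * v j * (starRingEnd ℂ) (v h) * v k) =
      ∑ h, (starRingEnd ℂ) (v h) *
        (-(∑ j, ∑ k, ∑ i, v j * v k * w i * delbar L (Lc L i j k) h p) -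
          ∑ k, ∑ l, v k * delbar L (Nc L l k) h p * ∑ i, w i * ∑ j, v j * Cc L i j l p) := by
  have hr (j h k : Fin n) (Y : Fin n → ℂ) : ∑ r, (∑ i, gm L i r p * Y i) *
      (starRingEnd ℂ) (v r) * v j * (starRingEnd ℂ) (v h) * v k =
        (starRingEnd ℂ) (v h) * ∑ i, v j * v k * w i * Y i := by
    simp only [← hw, Finset.mul_sum, Finset.sum_mul]
    rw [Finset.sum_comm]
    exact Finset.sum_congr rfl fun i _ => Finset.sum_congr rfl fun r _ => by ring
  rw [Finset.sum_comm]
  calc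
    _ = ∑ j, ∑ h, ∑ k, (starRingEnd ℂ) (v h) * ∑ i, v j * v k * w i *
        (-(delbar L (Lc L i j k) h p) - ∑ l, delbar L (Nc L l k) h p * Cc L i j l p) := by
      refine Finset.sum_congr rfl fun j _ => ?_
      rw [Finset.sum_comm]
      refine Finset.sum_congr rfl fun h _ => ?_
      rw [Finset.sum_comm]
      exact Finset.sum_congr rfl fun k _ => hr j h k _
    _ = _ := by
      rw [Finset.sum_comm]
      refine Finset.sum_congr rfl fun h _ => ?_
      simp only [← Finset.mul_sum, mul_sub, mul_neg, Finset.sum_sub_distrib,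
        Finset.sum_neg_distrib]
      congr 2
      rw [Finset.sum_comm]
      simp only [Finset.mul_sum]
      refine Finset.sum_congr rfl fun k _ => ?_
      rw [Finset.sum_comm, Finset.sum_comm (γ := Fin n) (s := Finset.univ) (t := Finset.univ)
        (f := fun l i => ∑ j, v k * delbar L (Nc L l k) h p * (w i * (v j * Cc L i j l p)))]
      refine Finset.sum_congr rfl fun i _ => ?_
      rw [Finset.sum_comm]
      exact Finset.sum_congr rfl fun l _ => Finset.sum_congr rfl fun j _ => by ring

end Frame

theorem conj_mup_zero {L : Pt 2 → ℂ} {p : Pt 2} :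
    (starRingEnd ℂ) (mup L 0 p) = -(starRingEnd ℂ) (llow L 1 p) / sg L p := by
  simp [mup, sg]

theorem conj_mup_one {L : Pt 2 → ℂ} {p : Pt 2} :
    (starRingEnd ℂ) (mup L 1 p) = (starRingEnd ℂ) (llow L 0 p) / sg L p := by
  simp [mup, sg]

namespace IsCFM

open scoped ComplexOrder

theorem posDef_gmat {D : Set (Pt n)} {L : Pt n → ℂ} (hL : IsCFM n D L) {p : Pt n} (hp : p ∈ D) :
    (gmat L p).PosDef := by
  have hH : (gmat L p).IsHermitian := by
    ext i j
    exact hL.hermitian p hp j i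
  refine .of_dotProduct_mulVec_pos hH fun x hx => ?_
  have h := hL.posdef p hp (star x) (by simpa using hx)
  have h' : ∑ i, ∑ j, gm L i j p * star x i * (starRingEnd ℂ) (star x j) =
      star x ⬝ᵥ (gmat L p).mulVec x := by
    simp only [dotProduct, Matrix.mulVec, Finset.mul_sum, gmat]
    refine Finset.sum_congr rfl fun i _ => Finset.sum_congr rfl fun j _ => ?_
    simp
    ring
  rw [h'] at h
  exact Complex.pos_iff.2 ⟨h, (hH.im_star_dotProduct_mulVec_self x).symm⟩

section General

variable {D : Set (Pt n)} {L : Pt n → ℂ} (hL : IsCFM n D L) {p : Pt n} (hp : p ∈ D)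

include hL

theorem contDiffOn_gm (i j : Fin n) : ContDiffOn ℝ ∞ (gm L i j) D :=
  (hL.smooth.debar hL.openD j).de hL.openD i

theorem contDiffOn_det : ContDiffOn ℝ ∞ (fun q => (gmat L q).det) D :=
  ContDiffOn.matrix_det fun i j => hL.contDiffOn_gm i j

theorem contDiffOn_gi (l i : Fin n) : ContDiffOn ℝ ∞ (gi L l i) D := by
  have hadj : ContDiffOn ℝ ∞ (fun q => (gmat L q).adjugate l i) D := by
    simp only [Matrix.adjugate_apply]
    refine ContDiffOn.matrix_det fun a b => ?_
    by_cases h : a = i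
    · simp only [h, Matrix.updateRow_self]
      exact contDiffOn_const
    · simp only [Matrix.updateRow_ne h]
      exact hL.contDiffOn_gm a b
  refine ((hL.contDiffOn_det.inv fun q hq => (hL.posDef_gmat hq).det_pos.ne').mul hadj).congr
    fun q _ => ?_
  simp [gi, Matrix.inv_def]

theorem contDiffOn_Nc (i k : Fin n) : ContDiffOn ℝ ∞ (Nc L i k) D :=
  ContDiffOn.sum fun m _ => ContDiffOn.sum fun l _ =>
    ((hL.contDiffOn_gi m i).mul ((hL.contDiffOn_gm l m).dz hL.openD k)).mul
      (contDiff_fibre l).contDiffOn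

theorem contDiffOn_Lc (i j k : Fin n) : ContDiffOn ℝ ∞ (Lc L i j k) D :=
  ContDiffOn.sum fun l _ => (hL.contDiffOn_gi l i).mul
    (((hL.contDiffOn_gm j l).dz hL.openD k).sub
      (ContDiffOn.sum fun m _ => (hL.contDiffOn_Nc m k).mul ((hL.contDiffOn_gm j l).de hL.openD m)))

theorem conj_eq {q : Pt n} (hq : q ∈ D) : (starRingEnd ℂ) (L q) = L q :=
  conj_eq_iff_im.2 (hL.real_im q hq)

include hp

theorem mem_nhds : D ∈ 𝓝 p := hL.openD.mem_nhds hp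

theorem differentiableAt_gm (i j : Fin n) : DifferentiableAt ℝ (gm L i j) p :=
  (hL.contDiffOn_gm i j).differentiableAt_of_isOpen hL.openD hp

theorem sum_gi_mul_gm (l k : Fin n) : ∑ i, gi L l i p * gm L i k p = if l = k then 1 else 0 := by
  have h : (gmat L p)⁻¹ * gmat L p = 1 :=
    Matrix.nonsing_inv_mul _ (hL.posDef_gmat hp).det_pos.ne'.isUnit
  have := congrFun (congrFun h l) k
  rwa [Matrix.mul_apply, Matrix.one_apply] at this

/-- Euler's identity for the antiholomorphic fibre directions. -/
theorem sum_conj_fibre_mul_debar : ∑ k, (starRingEnd ℂ) (p.2 k) * debar L k p = L p := by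
  have hd : HasFDerivAt L (fderiv ℝ L p) p :=
    (hL.smooth.differentiableAt_of_isOpen hL.openD hp).hasFDerivAt
  have key (c : ℂ) : fderiv ℝ L p (0, c • p.2) = 2 * c.re * L p := by
    have h1 : HasDerivAt (fun t : ℝ => ((p.1, (1 + t * c) • p.2) : Pt n)) (0, c • p.2) 0 := by
      refine (hasDerivAt_const 0 p.1).prodMk ?_
      have : HasDerivAt (fun t : ℝ => (1 + t * c : ℂ)) c 0 := by
        simpa using ((ofRealCLM.hasDerivAt (x := (0 : ℝ))).mul_const c).const_add 1
      simpa using this.smul_const p.2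
    have h2 : HasDerivAt (fun t : ℝ => L (p.1, (1 + t * c : ℂ) • p.2))
        (fderiv ℝ L p (0, c • p.2)) 0 :=
      HasFDerivAt.comp_hasDerivAt (x := (0 : ℝ)) (l := L) (by simpa using hd) h1
    have h3 : HasDerivAt (fun t : ℝ => ((1 + 2 * c.re * t + normSq c * t ^ 2 : ℝ) : ℂ) * L p)
        (2 * c.re * L p) 0 := by
      have : HasDerivAt (fun t : ℝ => (1 + 2 * c.re * t + normSq c * t ^ 2 : ℝ)) (2 * c.re) 0 := by
        simpa using ((((hasDerivAt_id (0 : ℝ)).const_mul (2 * c.re)).const_add 1).fun_add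
          (((hasDerivAt_id (0 : ℝ)).pow 2).const_mul (normSq c)))
      simpa using this.ofReal_comp.mul_const (L p)
    refine h2.unique (h3.congr_of_eventuallyEq ?_)
    have hne : ∀ᶠ t : ℝ in 𝓝 0, (1 + t * c : ℂ) ≠ 0 := by
      have : ContinuousAt (fun t : ℝ => (1 + t * c : ℂ)) 0 := by fun_prop
      exact this.eventually_ne (by simp)
    filter_upwards [hne] with t ht
    rw [hL.homog p hp _ ht]
    congr 2
    simp [normSq_apply]
    ring
  have h1 : ∑ k, (starRingEnd ℂ) (p.2 k) * debar L k p = 1 / 2 *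
      (fderiv ℝ L p (0, p.2) + I * fderiv ℝ L p (0, I • p.2)) := by
    rw [← sum_conj_mul_apply, Finset.mul_sum]
    exact Finset.sum_congr rfl fun k _ => by rw [debar]; ring
  have h2 := key 1
  rw [one_smul] at h2
  rw [h1, h2, key I]
  simp

theorem de_eq_sum (i : Fin n) : de L i p = ∑ j, gm L i j p * (starRingEnd ℂ) (p.2 j) := by
  have h : (fun q => ∑ k, (starRingEnd ℂ) (q.2 k) * debar L k q) =ᶠ[𝓝 p] L :=
    Filter.eventuallyEq_of_mem (hL.mem_nhds hp) fun q hq => hL.sum_conj_fibre_mul_debar hq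
  have hd (k : Fin n) : DifferentiableAt ℝ (debar L k) p :=
    (hL.smooth.debar hL.openD k).differentiableAt_of_isOpen hL.openD hp
  have T := isTangent_de i p
  rw [← T.map_congr h, T.map_sum_mul _ (fun k _ => (differentiableAt_fibre k p).starRingEnd)
    fun k _ => hd k]
  refine Finset.sum_congr rfl fun k _ => ?_
  rw [de_conj_fibre, gm]
  ring

theorem debar_eq_sum (j : Fin n) : debar L j p = ∑ i, gm L i j p * p.2 i := by
  have h : (fun q => (starRingEnd ℂ) (L q)) =ᶠ[𝓝 p] L :=
    Filter.eventuallyEq_of_mem (hL.mem_nhds hp) fun q hq => hL.conj_eq hq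
  rw [← (isTangent_debar j p).map_congr h, debar_conj, hL.de_eq_sum hp, map_sum]
  simp [hL.hermitian p hp]

theorem eq_sum_gm : L p = ∑ i, p.2 i * ∑ j, gm L i j p * (starRingEnd ℂ) (p.2 j) := by
  rw [← hL.sum_conj_fibre_mul_debar hp]
  simp only [hL.debar_eq_sum hp, Finset.mul_sum]
  rw [Finset.sum_comm]
  exact Finset.sum_congr rfl fun i _ => Finset.sum_congr rfl fun j _ => by ring

/-- `g_{ij̄}` is homogeneous of degree zero. -/
theorem sum_de_gm_mul_fibre (j l : Fin n) : ∑ i, de (gm L i j) l p * p.2 i = 0 := by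
  have h : debar L j =ᶠ[𝓝 p] fun q => ∑ i, gm L i j q * q.2 i :=
    Filter.eventuallyEq_of_mem (hL.mem_nhds hp) fun q hq => hL.debar_eq_sum hq j
  have hd (i : Fin n) := hL.differentiableAt_gm hp i j
  have T := isTangent_de l p
  have h1 := T.map_congr h
  rw [T.map_sum_mul _ (fun i _ => hd i) fun i _ => differentiableAt_fibre i p] at h1
  simp only [de_fibre, Finset.sum_add_distrib,
    mul_ite, mul_one, mul_zero, Finset.sum_ite_eq', Finset.mem_univ, if_true] at h1
  exact right_eq_add.1 ((rfl : gm L l j p = _).trans h1)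

theorem de_gm_comm (i j l : Fin n) : de (gm L i j) l p = de (gm L l j) i p :=
  de_comm (hL.smooth.debar hL.openD j) hL.openD hp i l

theorem sum_Nc_mul_gm (k m : Fin n) :
    ∑ j, Nc L j k p * gm L j m p = ∑ l, dz (gm L l m) k p * p.2 l := by
  have h : ∑ j, Nc L j k p * gm L j m p =
      ∑ m', (∑ l, dz (gm L l m') k p * p.2 l) * ∑ j, gi L m' j p * gm L j m p := by
    simp only [Nc, Finset.sum_mul, Finset.mul_sum]
    rw [Finset.sum_comm]
    exact Finset.sum_congr rfl fun a _ => Finset.sum_congr rfl fun b _ =>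
      Finset.sum_congr rfl fun c _ => by ring
  rw [h]
  simp [hL.sum_gi_mul_gm hp]

theorem sum_Lc_mul_gm (j k r : Fin n) :
    ∑ i, Lc L i j k p * gm L i r p = del L (gm L j r) k p := by
  have h : ∑ i, Lc L i j k p * gm L i r p =
      ∑ l, del L (gm L j l) k p * ∑ i, gi L l i p * gm L i r p := by
    simp only [Lc, Finset.sum_mul, Finset.mul_sum]
    rw [Finset.sum_comm]
    exact Finset.sum_congr rfl fun b _ => Finset.sum_congr rfl fun c _ => by ring
  rw [h]
  simp [hL.sum_gi_mul_gm hp]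

/-- The nonlinear connection is `N^i_k = L^i_{jk} η^j`. -/
theorem Nc_eq_sum_Lc (i k : Fin n) : Nc L i k p = ∑ j, Lc L i j k p * p.2 j := by
  have h (l : Fin n) : ∑ j, del L (gm L j l) k p * p.2 j = ∑ j, dz (gm L j l) k p * p.2 j := by
    simp only [del, sub_mul, Finset.sum_sub_distrib, Finset.sum_mul]
    rw [Finset.sum_comm]
    simp only [mul_assoc, ← Finset.mul_sum, hL.sum_de_gm_mul_fibre hp, mul_zero,
      Finset.sum_const_zero, sub_zero]
  simp only [Lc, Finset.sum_mul]
  rw [Finset.sum_comm]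
  simp only [mul_assoc, ← Finset.mul_sum, h]
  simp only [Nc, Finset.mul_sum, mul_assoc]

theorem sum_Cc_mul_fibre (i l : Fin n) : ∑ j, Cc L i j l p * p.2 j = 0 := by
  simp only [Cc, Finset.sum_mul]
  rw [Finset.sum_comm]
  simp only [mul_assoc, ← Finset.mul_sum, hL.sum_de_gm_mul_fibre hp, mul_zero,
    Finset.sum_const_zero]

theorem Cc_comm (i j l : Fin n) : Cc L i j l p = Cc L i l j p := by
  simp only [Cc, hL.de_gm_comm hp j _ l]

theorem del_sum_gm_mul_fibre (j k : Fin n) :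
    del L (fun q => ∑ i, gm L i j q * q.2 i) k p = 0 := by
  have hd (i : Fin n) := hL.differentiableAt_gm hp i j
  have hz : dz (fun q => ∑ i, gm L i j q * q.2 i) k p = ∑ i, dz (gm L i j) k p * p.2 i := by
    have T := isTangent_dz k p
    rw [T.map_sum_mul _ (fun i _ => hd i) fun i _ => differentiableAt_fibre i p]
    simp only [dz_fibre, mul_zero, add_zero]
  have he (l : Fin n) : de (fun q => ∑ i, gm L i j q * q.2 i) l p = gm L l j p :=
    ((isTangent_de l p).map_congr (Filter.eventuallyEq_of_mem (hL.mem_nhds hp)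
      fun q hq => (hL.debar_eq_sum hq j).symm)).trans rfl
  simp only [del, hz, he, hL.sum_Nc_mul_gm hp, sub_self]

theorem delbar_sum_gm_mul_conj_fibre (i k : Fin n) :
    delbar L (fun q => ∑ j, gm L i j q * (starRingEnd ℂ) (q.2 j)) k p = 0 := by
  have h : (fun q => ∑ j, gm L i j q * (starRingEnd ℂ) (q.2 j)) =ᶠ[𝓝 p]
      fun q => (starRingEnd ℂ) (∑ j, gm L j i q * q.2 j) :=
    Filter.eventuallyEq_of_mem (hL.mem_nhds hp) fun q hq => by
      simp [hL.hermitian q hq]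
  rw [(isTangent_delbar k p L).map_congr h, delbar_conj, hL.del_sum_gm_mul_fibre hp, map_zero]

theorem delbar_self (k : Fin n) : delbar L L k p = 0 := by
  have h : L =ᶠ[𝓝 p] fun q => ∑ i, q.2 i * ∑ j, gm L i j q * (starRingEnd ℂ) (q.2 j) :=
    Filter.eventuallyEq_of_mem (hL.mem_nhds hp) fun q hq => hL.eq_sum_gm hq
  have hd (i : Fin n) :
      DifferentiableAt ℝ (fun q => ∑ j, gm L i j q * (starRingEnd ℂ) (q.2 j)) p :=
    DifferentiableAt.fun_sum fun j _ =>
      (hL.differentiableAt_gm hp i j).mul (differentiableAt_fibre j p).starRingEnd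
  have T := isTangent_delbar k p L
  rw [T.map_congr h, T.map_sum_mul _ (fun i _ => differentiableAt_fibre i p)
    fun i _ => hd i]
  simp only [delbar_fibre,
    hL.delbar_sum_gm_mul_conj_fibre hp, zero_mul, mul_zero, add_zero, Finset.sum_const_zero]

theorem Fh_mul_self : Fh L p * Fh L p = L p := by
  rw [Fh, ← ofReal_mul, Real.mul_self_sqrt (hL.pos p hp).le]
  exact conj_eq_iff_re.1 (hL.conj_eq hp)

theorem Fh_ne_zero : Fh L p ≠ 0 :=
  ofReal_ne_zero.2 (Real.sqrt_pos.2 (hL.pos p hp)).ne'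

theorem differentiableAt_Fh : DifferentiableAt ℝ (Fh L) p :=
  ofRealCLM.differentiableAt.comp p
    ((reCLM.differentiableAt.comp p
      (hL.smooth.differentiableAt_of_isOpen hL.openD hp)).sqrt (hL.pos p hp).ne')

theorem delbar_Fh (k : Fin n) : delbar L (Fh L) k p = 0 := by
  have T := isTangent_delbar k p L
  have hF := hL.differentiableAt_Fh hp
  have h := T.map_congr (Filter.eventuallyEq_of_mem (hL.mem_nhds hp)
    fun q hq => hL.Fh_mul_self hq)
  rw [hL.delbar_self hp, T.map_mul hF hF] at h
  have h0 := hL.Fh_ne_zero hp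
  exact (mul_eq_zero.1 (by linear_combination h : (2 * Fh L p) * delbar L (Fh L) k p = 0)).resolve_left
    (by simpa using h0)

theorem differentiableAt_lup (i : Fin n) : DifferentiableAt ℝ (lup L i) p :=
  (differentiableAt_fibre i p).div_complex (hL.differentiableAt_Fh hp) (hL.Fh_ne_zero hp)

theorem differentiableAt_llow (i : Fin n) : DifferentiableAt ℝ (llow L i) p :=
  (DifferentiableAt.fun_sum fun j _ => (hL.differentiableAt_gm hp i j).fun_mul
    (differentiableAt_fibre j p).starRingEnd).div_complex (hL.differentiableAt_Fh hp)
    (hL.Fh_ne_zero hp)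

theorem delbar_eq_zero_of_mul_Fh {f g : Pt n → ℂ} (hf : DifferentiableAt ℝ f p)
    (hfg : ∀ q ∈ D, f q * Fh L q = g q) {k : Fin n} (hg : delbar L g k p = 0) :
    delbar L f k p = 0 := by
  have T := isTangent_delbar k p L
  have h := T.map_congr (Filter.eventuallyEq_of_mem (hL.mem_nhds hp) hfg)
  rw [hg, T.map_mul hf (hL.differentiableAt_Fh hp), hL.delbar_Fh hp, mul_zero, add_zero] at h
  exact (mul_eq_zero.1 h).resolve_right (hL.Fh_ne_zero hp)

theorem delbar_lup (i k : Fin n) : delbar L (lup L i) k p = 0 :=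
  hL.delbar_eq_zero_of_mul_Fh hp (hL.differentiableAt_lup hp i)
    (fun _ hq => div_mul_cancel₀ _ (hL.Fh_ne_zero hq)) (delbar_fibre k p L i)

theorem delbar_llow (i k : Fin n) : delbar L (llow L i) k p = 0 :=
  hL.delbar_eq_zero_of_mul_Fh hp (hL.differentiableAt_llow hp i)
    (fun _ hq => div_mul_cancel₀ _ (hL.Fh_ne_zero hq)) (hL.delbar_sum_gm_mul_conj_fibre hp i k)

theorem Fh_mul_lup (i : Fin n) : Fh L p * lup L i p = p.2 i :=
  mul_div_cancel₀ _ (hL.Fh_ne_zero hp)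

theorem conj_llow (j : Fin n) :
    (starRingEnd ℂ) (llow L j p) = ∑ i, gm L i j p * lup L i p := by
  rw [← sum_gm_mul_conj_lup, map_sum]
  simp [hL.hermitian p hp]

theorem sum_lup_mul_llow : ∑ i, lup L i p * llow L i p = 1 := by
  have h0 := hL.Fh_ne_zero hp
  have h1 : (∑ i, lup L i p * llow L i p) * (Fh L p * Fh L p) = L p := by
    rw [hL.eq_sum_gm hp, Finset.sum_mul]
    refine Finset.sum_congr rfl fun i _ => ?_
    rw [lup, llow]
    field_simp
  rw [hL.Fh_mul_self hp] at h1
  refine mul_right_cancel₀ (b := L p) ?_ (by rw [h1, one_mul])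
  rw [← hL.Fh_mul_self hp]
  exact mul_ne_zero h0 h0

theorem sum_lup_mul_Cc (i l : Fin n) : ∑ j, lup L j p * Cc L i j l p = 0 := by
  have h := hL.sum_Cc_mul_fibre hp i l
  simp only [lup, div_mul_eq_mul_div, ← Finset.sum_div]
  rw [← h]
  simp [h, mul_comm (p.2 _)]

theorem det_re_pos : 0 < (gmat L p).det.re :=
  (Complex.pos_iff.1 (hL.posDef_gmat hp).det_pos).1

theorem conj_det : (starRingEnd ℂ) (gmat L p).det = (gmat L p).det :=
  conj_eq_iff_im.2 (Complex.pos_iff.1 (hL.posDef_gmat hp).det_pos).2.symm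

theorem sg_mul_self : sg L p * sg L p = (gmat L p).det := by
  rw [sg, ← ofReal_mul, Real.mul_self_sqrt (hL.det_re_pos hp).le]
  exact conj_eq_iff_re.1 (hL.conj_det hp)

theorem sg_ne_zero : sg L p ≠ 0 :=
  ofReal_ne_zero.2 (Real.sqrt_pos.2 (hL.det_re_pos hp)).ne'

theorem differentiableAt_det : DifferentiableAt ℝ (fun q => (gmat L q).det) p :=
  hL.contDiffOn_det.differentiableAt_of_isOpen hL.openD hp

theorem differentiableAt_sg : DifferentiableAt ℝ (sg L) p :=
  ofRealCLM.differentiableAt.comp p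
    ((reCLM.differentiableAt.comp p (hL.differentiableAt_det hp)).sqrt (hL.det_re_pos hp).ne')

end General

section Surface

variable {D : Set (Pt 2)} {L : Pt 2 → ℂ} (hL : IsCFM 2 D L) {p : Pt 2} (hp : p ∈ D)

include hL hp

theorem del_det (s : Fin 2) :
    del L (fun q => (gmat L q).det) s p = (∑ i, Lc L i i s p) * (gmat L p).det := by
  have T := isTangent_del s p L
  have hd := hL.differentiableAt_gm hp
  simp only [Matrix.det_fin_two, gmat]
  rw [T.map_sub ((hd 0 0).fun_mul (hd 1 1)) ((hd 0 1).fun_mul (hd 1 0)), T.map_mul (hd 0 0) (hd 1 1),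
    T.map_mul (hd 0 1) (hd 1 0)]
  simp only [← hL.sum_Lc_mul_gm hp, Fin.sum_univ_two]
  ring

theorem delbar_det (s : Fin 2) : delbar L (fun q => (gmat L q).det) s p =
    (starRingEnd ℂ) (∑ i, Lc L i i s p) * (gmat L p).det := by
  have h : (fun q => (gmat L q).det) =ᶠ[𝓝 p] fun q => (starRingEnd ℂ) (gmat L q).det :=
    Filter.eventuallyEq_of_mem (hL.mem_nhds hp) fun q hq => (hL.conj_det hq).symm
  rw [(isTangent_delbar s p L).map_congr h, delbar_conj, hL.del_det hp, map_mul, hL.conj_det hp]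

theorem delbar_sg (s : Fin 2) :
    delbar L (sg L) s p = (starRingEnd ℂ) (∑ i, Lc L i i s p) / 2 * sg L p := by
  have T := isTangent_delbar s p L
  have hd := hL.differentiableAt_sg hp
  have h := T.map_congr (Filter.eventuallyEq_of_mem (hL.mem_nhds hp)
    fun q hq => hL.sg_mul_self hq)
  rw [hL.delbar_det hp, ← hL.sg_mul_self hp, T.map_mul hd hd] at h
  exact mul_right_cancel₀ (hL.sg_ne_zero hp) (by linear_combination h / 2)

theorem differentiableAt_mup (i : Fin 2) : DifferentiableAt ℝ (mup L i) p := by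
  have h0 := hL.sg_ne_zero hp
  have hd := hL.differentiableAt_sg hp
  fin_cases i
  · exact (hL.differentiableAt_llow hp 1).fun_neg.div_complex hd h0
  · exact (hL.differentiableAt_llow hp 0).div_complex hd h0

theorem delbar_mup (i s : Fin 2) : delbar L (mup L i) s p =
    -((starRingEnd ℂ) (∑ i, Lc L i i s p) / 2) * mup L i p := by
  have h0 := hL.sg_ne_zero hp
  have T := isTangent_delbar s p L
  have key : delbar L (fun q => mup L i q * sg L q) s p = 0 := by
    fin_cases i
    · have h : (fun q => mup L 0 q * sg L q) =ᶠ[𝓝 p] fun q => (-1) * llow L 1 q :=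
        Filter.eventuallyEq_of_mem (hL.mem_nhds hp) fun q hq => by
          simp [mup, hL.sg_ne_zero hq]
      refine (T.map_congr h).trans ?_
      rw [T.map_mul (differentiableAt_const _) (hL.differentiableAt_llow hp 1), T.map_const,
        hL.delbar_llow hp]
      simp
    · have h : (fun q => mup L 1 q * sg L q) =ᶠ[𝓝 p] llow L 0 :=
        Filter.eventuallyEq_of_mem (hL.mem_nhds hp) fun q hq => by
          simp [mup, hL.sg_ne_zero hq]
      exact (T.map_congr h).trans (hL.delbar_llow hp 0 s)
  rw [T.map_mul (hL.differentiableAt_mup hp i) (hL.differentiableAt_sg hp), hL.delbar_sg hp] at key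
  exact mul_right_cancel₀ h0 (by linear_combination key)

theorem mlow_zero : mlow L 0 p = -(sg L p * lup L 1 p) := by
  have h0 := hL.sg_ne_zero hp
  have h := hL.sg_mul_self hp
  simp only [Matrix.det_fin_two, gmat] at h
  rw [mlow, Fin.sum_univ_two, conj_mup_zero, conj_mup_one, hL.conj_llow hp,
    hL.conj_llow hp, Fin.sum_univ_two, Fin.sum_univ_two]
  field_simp
  linear_combination lup L 1 p * h

theorem mlow_one : mlow L 1 p = sg L p * lup L 0 p := by
  have h0 := hL.sg_ne_zero hp
  have h := hL.sg_mul_self hp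
  simp only [Matrix.det_fin_two, gmat] at h
  rw [mlow, Fin.sum_univ_two, conj_mup_zero, conj_mup_one, hL.conj_llow hp,
    hL.conj_llow hp, Fin.sum_univ_two, Fin.sum_univ_two]
  field_simp
  linear_combination (-lup L 0 p) * h

/-- The Berwald frame and its coframe are dual. -/
theorem lup_mul_llow_add_mup_mul_mlow (i j : Fin 2) :
    lup L j p * llow L i p + mup L j p * mlow L i p = if i = j then 1 else 0 := by
  have h0 := hL.sg_ne_zero hp
  have h := hL.sum_lup_mul_llow hp
  rw [Fin.sum_univ_two] at h
  fin_cases i <;> fin_cases j <;>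
    simp only [Fin.zero_eta, Fin.mk_one, Fin.isValue, mup, hL.mlow_zero hp, hL.mlow_one hp,
      if_true, one_ne_zero, zero_ne_one, if_false] <;>
    field_simp
  · linear_combination h
  · ring
  · ring
  · linear_combination h

theorem differentiableAt_mlow (i : Fin 2) : DifferentiableAt ℝ (mlow L i) p :=
  DifferentiableAt.fun_sum fun j _ => (hL.differentiableAt_gm hp i j).fun_mul
    (hL.differentiableAt_mup hp j).starRingEnd

theorem delbar_mlow (i s : Fin 2) : delbar L (mlow L i) s p =
    (starRingEnd ℂ) (∑ i, Lc L i i s p) / 2 * mlow L i p := by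
  have T := isTangent_delbar s p L
  have hd := hL.differentiableAt_sg hp
  fin_cases i
  · have h : mlow L 0 =ᶠ[𝓝 p] fun q => sg L q * ((-1) * lup L 1 q) :=
      Filter.eventuallyEq_of_mem (hL.mem_nhds hp) fun q hq => by
        simp [hL.mlow_zero hq]
    refine (T.map_congr h).trans ?_
    rw [T.map_mul hd ((hL.differentiableAt_lup hp 1).const_mul _),
      T.map_mul (differentiableAt_const _) (hL.differentiableAt_lup hp 1), T.map_const,
      hL.delbar_lup hp, hL.delbar_sg hp]
    simp only [Fin.zero_eta, hL.mlow_zero hp]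
    ring
  · have h : mlow L 1 =ᶠ[𝓝 p] fun q => sg L q * lup L 0 q :=
      Filter.eventuallyEq_of_mem (hL.mem_nhds hp) fun q hq => hL.mlow_one hq
    refine (T.map_congr h).trans ?_
    rw [T.map_mul hd (hL.differentiableAt_lup hp 0), hL.delbar_lup hp, hL.delbar_sg hp]
    simp only [Fin.mk_one, hL.mlow_one hp]
    ring

theorem differentiableAt_Lc (i j k : Fin 2) : DifferentiableAt ℝ (Lc L i j k) p :=
  (hL.contDiffOn_Lc i j k).differentiableAt_of_isOpen hL.openD hp

theorem delbar_sJ (s : Fin 2) : delbar L (sJ L) s p =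
    ∑ j, ∑ k, ∑ i, lup L j p * lup L k p * llow L i p * delbar L (Lc L i j k) s p := by
  have hl := hL.differentiableAt_lup hp
  have h := (isTangent_delbar s p L).map_contraction (a := 0) (b := 0) (c := 0) hl hl
    (hL.differentiableAt_llow hp) (hL.differentiableAt_Lc hp)
    (fun i => by rw [hL.delbar_lup hp, zero_mul]) (fun i => by rw [hL.delbar_lup hp, zero_mul])
    (fun i => by rw [hL.delbar_llow hp, zero_mul])
  exact h.trans (by ring)

theorem delbar_sE (s : Fin 2) : delbar L (sE L) s p =
    ∑ j, ∑ k, ∑ i, lup L j p * mup L k p * mlow L i p * delbar L (Lc L i j k) s p := by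
  have h := (isTangent_delbar s p L).map_contraction (a := 0) (hL.differentiableAt_lup hp)
    (hL.differentiableAt_mup hp) (hL.differentiableAt_mlow hp) (hL.differentiableAt_Lc hp)
    (fun i => by rw [hL.delbar_lup hp, zero_mul]) (fun i => hL.delbar_mup hp i s)
    (fun i => hL.delbar_mlow hp i s)
  exact h.trans (by ring)

theorem delbar_sH (s : Fin 2) : delbar L (sH L) s p =
    (∑ j, ∑ k, ∑ i, mup L j p * mup L k p * mlow L i p * delbar L (Lc L i j k) s p) -
      (starRingEnd ℂ) (∑ i, Lc L i i s p) / 2 * sH L p := by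
  have hm := hL.differentiableAt_mup hp
  have h := (isTangent_delbar s p L).map_contraction hm hm
    (hL.differentiableAt_mlow hp) (hL.differentiableAt_Lc hp)
    (fun i => hL.delbar_mup hp i s) (fun i => hL.delbar_mup hp i s)
    (fun i => hL.delbar_mlow hp i s)
  exact h.trans (by rw [sH]; ring)

theorem delbar_Nc (i k s : Fin 2) :
    delbar L (Nc L i k) s p = ∑ j, delbar L (Lc L i j k) s p * p.2 j := by
  have T := isTangent_delbar s p L
  rw [T.map_congr (Filter.eventuallyEq_of_mem (hL.mem_nhds hp)
      fun q hq => hL.Nc_eq_sum_Lc hq i k),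
    T.map_sum_mul _ (fun j _ => hL.differentiableAt_Lc hp i j k)
      fun j _ => differentiableAt_fibre j p]
  simp only [delbar_fibre, mul_zero, add_zero]

theorem Fh_mul_delbar_sE (s : Fin 2) : Fh L p * delbar L (sE L) s p =
    ∑ k, ∑ l, mup L k p * delbar L (Nc L l k) s p * mlow L l p := by
  simp only [hL.delbar_sE hp, hL.delbar_Nc hp, Fin.sum_univ_two, ← hL.Fh_mul_lup hp]
  ring

theorem sV_add_sH : sV L p + sH L p = ∑ s, mup L s p * ∑ i, Lc L i i s p := by
  have h (i j : Fin 2) := hL.lup_mul_llow_add_mup_mul_mlow hp i j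
  have h00 := h 0 0
  have h01 := h 0 1
  have h10 := h 1 0
  have h11 := h 1 1
  simp only [if_true, zero_ne_one, one_ne_zero, if_false] at h00 h01 h10 h11
  simp only [sV, sH, Fin.sum_univ_two]
  linear_combination (mup L 0 p * Lc L 0 0 0 p + mup L 1 p * Lc L 0 0 1 p) * h00 +
    (mup L 0 p * Lc L 0 1 0 p + mup L 1 p * Lc L 0 1 1 p) * h01 +
    (mup L 0 p * Lc L 1 0 0 p + mup L 1 p * Lc L 1 0 1 p) * h10 +
    (mup L 0 p * Lc L 1 1 0 p + mup L 1 p * Lc L 1 1 1 p) * h11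

theorem sum_mlow_mul_mup_mul_Cc (l : Fin 2) :
    ∑ i, mlow L i p * ∑ j, mup L j p * Cc L i j l p = sB L p * mlow L l p := by
  have hz (i j : Fin 2) : ∑ l, lup L l p * Cc L i j l p = 0 := by
    simp only [hL.Cc_comm hp i j, hL.sum_lup_mul_Cc hp]
  have h (l' : Fin 2) := hL.lup_mul_llow_add_mup_mul_mlow hp l l'
  have hC (i j : Fin 2) :
      Cc L i j l p = (∑ l', mup L l' p * Cc L i j l' p) * mlow L l p := by
    calc Cc L i j l p = ∑ l', (if l = l' then 1 else 0) * Cc L i j l' p := by simp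
      _ = ∑ l', (lup L l' p * llow L l p + mup L l' p * mlow L l p) * Cc L i j l' p := by
        simp only [h]
      _ = (∑ l', lup L l' p * Cc L i j l' p) * llow L l p +
          (∑ l', mup L l' p * Cc L i j l' p) * mlow L l p := by
        simp only [Fin.sum_univ_two]; ring
      _ = _ := by rw [hz, zero_mul, zero_add]
  simp only [hC, sB, Fin.sum_univ_two]
  ring

theorem sum_Rh_lup : (∑ r, ∑ j, ∑ h, ∑ k, Rh L r j h k p * (starRingEnd ℂ) (lup L r p) *
    lup L j p * (starRingEnd ℂ) (lup L h p) * lup L k p) = hK L p := by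
  refine (sum_Rh (fun i => lup L i p) _ sum_gm_mul_conj_lup).trans ?_
  simp only [hL.sum_lup_mul_Cc hp, mul_zero, Finset.sum_const_zero, sub_zero, hK,
    ← hL.delbar_sJ hp, conj_lup, Finset.mul_sum]
  exact Finset.sum_congr rfl fun h _ => by ring

theorem sum_Rh_mup : (∑ r, ∑ j, ∑ h, ∑ k, Rh L r j h k p * (starRingEnd ℂ) (mup L r p) *
    mup L j p * (starRingEnd ℂ) (mup L h p) * mup L k p) = hW L p := by
  refine (sum_Rh (fun i => mup L i p) (fun i => mlow L i p) fun _ => rfl).trans ?_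
  have hE : sB L p * Fh L p * ∑ s, delbar L (sE L) s p * (starRingEnd ℂ) (mup L s p) =
      ∑ s, (starRingEnd ℂ) (mup L s p) * ∑ k, ∑ l, mup L k p * delbar L (Nc L l k) s p *
        (sB L p * mlow L l p) := by
    rw [Finset.mul_sum]
    refine Finset.sum_congr rfl fun s _ => ?_
    have h := hL.Fh_mul_delbar_sE hp s
    simp only [Fin.sum_univ_two] at h ⊢
    linear_combination (sB L p * (starRingEnd ℂ) (mup L s p)) * h
  simp only [hL.sum_mlow_mul_mup_mul_Cc hp]
  rw [hW, hE, ← map_add, hL.sV_add_sH hp, map_sum]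
  simp only [hL.delbar_sH hp, map_mul, Fin.sum_univ_two]
  ring

end Surface

end IsCFM

/-- the horizontal holomorphic sectional curvatures in directions
`λ` and `μ` are `2K` and `2W`. -/
theorem statement12 (D : Set (Pt 2)) (L : Pt 2 → ℂ) (hL : IsCFM 2 D L) :
    ∀ p ∈ D,
      (∑ r, ∑ j, ∑ h, ∑ k, Rh L r j h k p * (starRingEnd ℂ) (lup L r p) *
        lup L j p * (starRingEnd ℂ) (lup L h p) * lup L k p) = hK L p ∧
      (∑ r, ∑ j, ∑ h, ∑ k, Rh L r j h k p * (starRingEnd ℂ) (mup L r p) *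
        mup L j p * (starRingEnd ℂ) (mup L h p) * mup L k p) = hW L p ∧
      2 * (∑ r, ∑ j, ∑ h, ∑ k, Rh L r j h k p * (starRingEnd ℂ) (lup L r p) *
        lup L j p * (starRingEnd ℂ) (lup L h p) * lup L k p) = 2 * hK L p ∧
      2 * (∑ r, ∑ j, ∑ h, ∑ k, Rh L r j h k p * (starRingEnd ℂ) (mup L r p) *
        mup L j p * (starRingEnd ℂ) (mup L h p) * mup L k p) = 2 * hW L p := by
  intro p hp
  have hl := hL.sum_Rh_lup hp
  have hm := hL.sum_Rh_mup hp
  exact ⟨hl, hm, congrArg _ hl, congrArg _ hm⟩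

end CFinsler
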